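/- Convergence of the vanishing viscosity method (Theorem 5.1). Assume the Hamiltonian H = (H^j) satisfies (H0)–(H6) and let β = (β_{ij}) with β_{ij} > 0 for all i ∈ I_T, j ∈ Inc_i. Let ε_n > 0 with ε_n → 0, and for each n let u_n ∈ C²_{*,β}(Γ) satisfy −ε_n ∂²_j u_n(x) + H^j(x, u_n(x), ∂_j u_n(x)) = 0 for all x ∈ (0,l_j) and all j ∈ J (together with the Kirchhoff conditions S^i_β u_n = 0, i ∈ I_T). Assume that the families (u_n) and (∂_j u_n) are uniformly bounded on Γ, and that u_n converges uniformly on Γ to a function u ∈ C(Γ). Then u is a viscosity solution of H(x, u, ∂u) = 0 on Γ. -/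

import Mathlib

open Set

noncomputable section

/-- A finite connected topological network. -/
structure Network where
  I : Type
  J : Type
  finI : Fintype I
  finJ : Fintype J
  neI : Nonempty I
  neJ : Nonempty J
  l : J → ℝ
  l_pos : ∀ j, 0 < l j
  s : J → I
  t : J → I
  st_ne : ∀ j, s j ≠ t j
  conn : ∀ i i' : I,
    Relation.ReflTransGen (fun a b => ∃ j, (s j = a ∧ t j = b) ∨ (s j = b ∧ t j = a)) i i'
  IB : Set I
  IB_ne : IB.Nonempty
  deg_one_bd : ∀ i : I, ({j : J | s j = i ∨ t j = i} : Set J).ncard = 1 → i ∈ IB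

attribute [instance] Network.finI Network.finJ Network.neI Network.neJ

namespace Network

open scoped Classical

variable (N : Network)

/-- The set of edges incident to the vertex `i`. -/
def Inc (i : N.I) : Set N.J := {j | N.s j = i ∨ N.t j = i}

/-- The set of transition vertices. -/
def IT : Set N.I := N.IBᶜ

/-- The signed incidence `a_{ij}`. -/
def sgn (i : N.I) (j : N.J) : ℝ := if N.s j = i then 1 else -1

/-- The parameter `y_i^j` of the vertex `i` on the edge `j`. -/
def param (i : N.I) (j : N.J) : ℝ := if N.s j = i then 0 else N.l j

/-- The edge `j` as a parameter interval. -/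
def edge (j : N.J) : Set ℝ := Icc 0 (N.l j)

/-- A family `(u^j)` of functions on the edges defines a function on the network iff
the values at each vertex agree. -/
def Compat (u : N.J → ℝ → ℝ) : Prop :=
  ∀ i : N.I, ∀ j ∈ N.Inc i, ∀ k ∈ N.Inc i, u j (N.param i j) = u k (N.param i k)

/-- `u ∈ C(Γ)`. -/
def IsCont (u : N.J → ℝ → ℝ) : Prop :=
  N.Compat u ∧ ∀ j, ContinuousOn (u j) (N.edge j)

/-- `u ∈ C²(Γ)`. -/
def IsC2 (u : N.J → ℝ → ℝ) : Prop :=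
  N.Compat u ∧ ∀ j, ContDiffOn ℝ 2 (u j) (N.edge j)

/-- First derivative `∂_j u` along the edge `j`. -/
def pd (u : N.J → ℝ → ℝ) (j : N.J) (x : ℝ) : ℝ := derivWithin (u j) (N.edge j) x

/-- Second derivative `∂²_j u` along the edge `j`. -/
def pd2 (u : N.J → ℝ → ℝ) (j : N.J) (x : ℝ) : ℝ := derivWithin (N.pd u j) (N.edge j) x

/-- Sum over the edges incident to `i`. -/
def incSum (i : N.I) (f : N.J → ℝ) : ℝ := ∑ j : N.J, if j ∈ N.Inc i then f j else 0

/-- The Kirchhoff sum `S^i_β u`. -/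
def kir (β : N.I → N.J → ℝ) (u : N.J → ℝ → ℝ) (i : N.I) : ℝ :=
  N.incSum i (fun j => β i j * N.sgn i j * N.pd u j (N.param i j))

/-- `u ∈ C²_{*,β}(Γ)`. -/
def IsC2Star (β : N.I → N.J → ℝ) (u : N.J → ℝ → ℝ) : Prop :=
  N.IsC2 u ∧ ∀ i ∈ N.IT, N.kir β u i = 0

/-- (H0): continuity of each `H^j`. -/
def H0 (H : N.J → ℝ → ℝ → ℝ → ℝ) : Prop :=
  ∀ j, ContinuousOn (fun q : ℝ × ℝ × ℝ => H j q.1 q.2.1 q.2.2)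
    ((N.edge j) ×ˢ (univ : Set ℝ) ×ˢ (univ : Set ℝ))

/-- (H1): `r ↦ H^j(x,r,p)` is nondecreasing. -/
def H1 (H : N.J → ℝ → ℝ → ℝ → ℝ) : Prop :=
  ∀ j, ∀ x ∈ N.edge j, ∀ p : ℝ, Monotone fun r => H j x r p

/-- (H3): `p ↦ H^j(v_i,r,p)` is nondecreasing on `(0,∞)` at transition vertices. -/
def H3 (H : N.J → ℝ → ℝ → ℝ → ℝ) : Prop :=
  ∀ i ∈ N.IT, ∀ j ∈ N.Inc i, ∀ r : ℝ,
    MonotoneOn (fun p => H j (N.param i j) r p) (Ioi (0 : ℝ))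

/-- (H4): coercivity in `p`, uniform on bounded `r`-sets. -/
def H4 (H : N.J → ℝ → ℝ → ℝ → ℝ) : Prop :=
  ∀ j, ∀ R : ℝ, 0 < R → ∀ A : ℝ, ∃ M : ℝ, ∀ x ∈ N.edge j, ∀ r : ℝ, |r| ≤ R →
    ∀ p : ℝ, M < |p| → A < H j x r p

/-- (H5): continuity of `H` at the transition vertices. -/
def H5 (H : N.J → ℝ → ℝ → ℝ → ℝ) : Prop :=
  ∀ i ∈ N.IT, ∀ j ∈ N.Inc i, ∀ k ∈ N.Inc i, ∀ r p : ℝ,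
    H j (N.param i j) r p = H k (N.param i k) r p

/-- (H6): symmetry of `H` in `p` at the transition vertices. -/
def H6 (H : N.J → ℝ → ℝ → ℝ → ℝ) : Prop :=
  ∀ i ∈ N.IT, ∀ j ∈ N.Inc i, ∀ r p : ℝ,
    H j (N.param i j) r p = H j (N.param i j) r (-p)

end Network

namespace Network

variable (N : Network)

/-- `u ∈ USC(Γ)`. -/
def IsUSC (u : N.J → ℝ → ℝ) : Prop :=
  N.Compat u ∧ ∀ j, UpperSemicontinuousOn (u j) (N.edge j)

/-- `u ∈ LSC(Γ)`. -/
def IsLSC (u : N.J → ℝ → ℝ) : Prop :=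
  N.Compat u ∧ ∀ j, LowerSemicontinuousOn (u j) (N.edge j)

/-- `φ` is a `(j,k)`-test function at the transition vertex `i`. -/
def IsTestJK (φ : N.J → ℝ → ℝ) (i : N.I) (j k : N.J) : Prop :=
  N.IsCont φ ∧
  DifferentiableWithinAt ℝ (φ j) (N.edge j) (N.param i j) ∧
  DifferentiableWithinAt ℝ (φ k) (N.edge k) (N.param i k) ∧
  N.sgn i j * N.pd φ j (N.param i j) + N.sgn i k * N.pd φ k (N.param i k) = 0

/-- `w` has a local maximum at the vertex `i` relative to `ē_j ∪ ē_k`. -/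
def LocalMaxVertex (w : N.J → ℝ → ℝ) (i : N.I) (j k : N.J) : Prop :=
  ∃ δ > 0, (∀ x ∈ N.edge j, |x - N.param i j| < δ → w j x ≤ w j (N.param i j)) ∧
           (∀ x ∈ N.edge k, |x - N.param i k| < δ → w k x ≤ w k (N.param i k))

/-- `w` has a local minimum at the vertex `i` relative to `ē_j ∪ ē_k`. -/
def LocalMinVertex (w : N.J → ℝ → ℝ) (i : N.I) (j k : N.J) : Prop :=
  ∃ δ > 0, (∀ x ∈ N.edge j, |x - N.param i j| < δ → w j (N.param i j) ≤ w j x) ∧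
           (∀ x ∈ N.edge k, |x - N.param i k| < δ → w k (N.param i k) ≤ w k x)

/-- `u` is a viscosity subsolution of `H(x,u,∂u) = 0` on `Γ`. -/
def IsSubsol (H : N.J → ℝ → ℝ → ℝ → ℝ) (u : N.J → ℝ → ℝ) : Prop :=
  N.IsUSC u ∧
  (∀ j : N.J, ∀ y ∈ Ioo 0 (N.l j), ∀ φ : N.J → ℝ → ℝ, N.IsCont φ →
    DifferentiableWithinAt ℝ (φ j) (N.edge j) y →
    (∃ δ > 0, ∀ x ∈ N.edge j, |x - y| < δ → u j x - φ j x ≤ u j y - φ j y) →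
    H j y (u j y) (N.pd φ j y) ≤ 0) ∧
  (∀ i ∈ N.IT, ∀ j ∈ N.Inc i, ∀ k ∈ N.Inc i, j ≠ k →
    ∀ φ : N.J → ℝ → ℝ, N.IsTestJK φ i j k →
    N.LocalMaxVertex (fun m x => u m x - φ m x) i j k →
    H j (N.param i j) (u j (N.param i j)) (N.pd φ j (N.param i j)) ≤ 0)

/-- `u` is a viscosity supersolution of `H(x,u,∂u) = 0` on `Γ`. -/
def IsSupersol (H : N.J → ℝ → ℝ → ℝ → ℝ) (u : N.J → ℝ → ℝ) : Prop :=
  N.IsLSC u ∧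
  (∀ j : N.J, ∀ y ∈ Ioo 0 (N.l j), ∀ φ : N.J → ℝ → ℝ, N.IsCont φ →
    DifferentiableWithinAt ℝ (φ j) (N.edge j) y →
    (∃ δ > 0, ∀ x ∈ N.edge j, |x - y| < δ → u j y - φ j y ≤ u j x - φ j x) →
    0 ≤ H j y (u j y) (N.pd φ j y)) ∧
  (∀ i ∈ N.IT, ∀ j ∈ N.Inc i, ∃ k ∈ N.Inc i, k ≠ j ∧
    ∀ φ : N.J → ℝ → ℝ, N.IsTestJK φ i j k →
    N.LocalMinVertex (fun m x => u m x - φ m x) i j k →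
    0 ≤ H j (N.param i j) (u j (N.param i j)) (N.pd φ j (N.param i j)))

/-- `u` is a viscosity solution of `H(x,u,∂u) = 0` on `Γ`. -/
def IsViscSol (H : N.J → ℝ → ℝ → ℝ → ℝ) (u : N.J → ℝ → ℝ) : Prop :=
  N.IsCont u ∧ N.IsSubsol H u ∧ N.IsSupersol H u

end Network

section VanishingViscosity

open Filter Topology

/-- Solutions `f n` on `[0, L]`, with first derivatives `g n`, of the equations
`ε n * f'' = G x f f'` with vanishing viscosities `ε n`, converging uniformly to `F`. -/
structure IsViscositySeq (ε : ℕ → ℝ) (L : ℝ) (G : ℝ → ℝ → ℝ → ℝ) (f g : ℕ → ℝ → ℝ)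
    (F : ℝ → ℝ) : Prop where
  length_pos : 0 < L
  eps_pos : ∀ n, 0 < ε n
  eps_lim : Tendsto ε atTop (𝓝 0)
  cont : ContinuousOn (fun q : ℝ × ℝ × ℝ => G q.1 q.2.1 q.2.2)
    (Icc 0 L ×ˢ (univ : Set ℝ) ×ˢ (univ : Set ℝ))
  deriv_fst : ∀ n, ∀ x ∈ Icc 0 L, HasDerivWithinAt (f n) (g n x) (Icc 0 L) x
  deriv_snd : ∀ n, ∀ x ∈ Icc 0 L, HasDerivWithinAt (g n) (G x (f n x) (g n x) / ε n) (Icc 0 L) x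
  lim : TendstoUniformlyOn f F atTop (Icc 0 L)

namespace IsViscositySeq

variable {ε : ℕ → ℝ} {L : ℝ} {G : ℝ → ℝ → ℝ → ℝ} {f g : ℕ → ℝ → ℝ} {F : ℝ → ℝ}

theorem neg (h : IsViscositySeq ε L G f g F) :
    IsViscositySeq ε L (fun x r q => -G x (-r) (-q)) (fun n x => -f n x) (fun n x => -g n x)
      (fun x => -F x) where
  length_pos := h.length_pos
  eps_pos := h.eps_pos
  eps_lim := h.eps_lim
  cont := by
    refine ContinuousOn.neg ?_
    refine h.cont.comp (f := fun q : ℝ × ℝ × ℝ => (q.1, -q.2.1, -q.2.2)) (by fun_prop) ?_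
    rintro ⟨x, r, q⟩ hq
    simpa using hq
  deriv_fst n x hx := (h.deriv_fst n x hx).neg
  deriv_snd n x hx := by
    simp only [neg_neg, neg_div]
    exact (h.deriv_snd n x hx).neg
  lim := by
    have := h.lim
    rw [Metric.tendstoUniformlyOn_iff] at this ⊢
    simpa using this

/-- Restriction to the subinterval issuing from `y` in the direction `σ = ±1`. -/
theorem pullback (h : IsViscositySeq ε L G f g F) {L' y σ : ℝ} (hL' : 0 < L') (hσ : σ * σ = 1)
    (hm : MapsTo (fun x => y + σ * x) (Icc 0 L') (Icc 0 L)) :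
    IsViscositySeq ε L' (fun x r q => G (y + σ * x) r (σ * q)) (fun n x => f n (y + σ * x))
      (fun n x => σ * g n (y + σ * x)) (fun x => F (y + σ * x)) where
  length_pos := hL'
  eps_pos := h.eps_pos
  eps_lim := h.eps_lim
  cont := by
    refine h.cont.comp (f := fun q : ℝ × ℝ × ℝ => (y + σ * q.1, q.2.1, σ * q.2.2))
      (by fun_prop) ?_
    rintro ⟨x, r, q⟩ hq
    simpa using hm hq.1
  deriv_fst n x hx := by
    have hc : HasDerivWithinAt (fun x => y + σ * x) σ (Icc 0 L') x := by
      simpa using ((hasDerivWithinAt_id x (Icc 0 L')).const_mul σ).const_add y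
    have := (h.deriv_fst n _ (hm hx)).comp x hc hm
    simpa [mul_comm, Function.comp_def] using this
  deriv_snd n x hx := by
    have hc : HasDerivWithinAt (fun x => y + σ * x) σ (Icc 0 L') x := by
      simpa using ((hasDerivWithinAt_id x (Icc 0 L')).const_mul σ).const_add y
    have := ((h.deriv_snd n _ (hm hx)).comp x hc hm).const_mul σ
    rw [← mul_assoc σ σ, hσ, one_mul]
    rwa [mul_left_comm, hσ, mul_one] at this
  lim := (h.lim.comp (fun x => y + σ * x)).mono fun _ hx => hm hx

theorem continuousOn (h : IsViscositySeq ε L G f g F) : ContinuousOn F (Icc 0 L) :=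
  h.lim.continuousOn <| .of_forall fun n x hx => (h.deriv_fst n x hx).continuousWithinAt

theorem hasDerivWithinAt_Ici {φ : ℝ → ℝ} {p x : ℝ} (hφ : HasDerivWithinAt φ p (Icc 0 L) x)
    (hx : x ∈ Ico 0 L) : HasDerivWithinAt φ p (Ici x) x :=
  hφ.mono_of_mem_nhdsWithin <|
    mem_of_superset (Icc_mem_nhdsGE hx.2) (Icc_subset_Icc_left hx.1)

theorem exists_uniform_lower_bound (h : IsViscositySeq ε L G f g F) {a s : ℝ}
    (hG : ∀ q ∈ Icc a s, 0 < G 0 (F 0) q) :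
    ∃ c > 0, ∃ η > 0, η ≤ L ∧ ∀ᶠ n in atTop, ∀ x ∈ Icc 0 η, ∀ q ∈ Icc a s,
      c < G x (f n x) q := by
  have h0 : (0 : ℝ) ∈ Icc 0 L := ⟨le_rfl, h.length_pos.le⟩
  obtain ⟨c, hc, hcG⟩ : ∃ c > 0, ∀ q ∈ Icc a s, c < G 0 (F 0) q := by
    have hcont : ContinuousOn (fun q => G 0 (F 0) q) (Icc a s) := by
      refine h.cont.comp (f := fun q : ℝ => ((0 : ℝ), F 0, q)) (by fun_prop) ?_
      intro q _
      simpa using h.length_pos.le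
    rcases (Icc a s).eq_empty_or_nonempty with he | hne
    · exact ⟨1, one_pos, by simp [he]⟩
    · obtain ⟨q₀, hq₀, hmin⟩ := isCompact_Icc.exists_isMinOn hne hcont
      refine ⟨G 0 (F 0) q₀ / 2, half_pos (hG _ hq₀), fun q hq => ?_⟩
      have : G 0 (F 0) q₀ ≤ G 0 (F 0) q := hmin hq
      have := hG _ hq₀
      linarith
  have key : ∀ᶠ z : ℝ × ℝ in 𝓝 (0, F 0), ∀ q ∈ Icc a s, z.1 ∈ Icc 0 L → c < G z.1 z.2 q := by
    refine isCompact_Icc.eventually_forall_of_forall_eventually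
      (P := fun (z : ℝ × ℝ) q => z.1 ∈ Icc 0 L → c < G z.1 z.2 q) fun q hq => ?_
    have h1 := (h.cont (0, F 0, q) (by simpa using h.length_pos.le)).eventually
      (lt_mem_nhds (hcG q hq))
    rw [eventually_nhdsWithin_iff] at h1
    have h2 : Tendsto (fun z : (ℝ × ℝ) × ℝ => (z.1.1, z.1.2, z.2)) (𝓝 ((0, F 0), q))
        (𝓝 (0, F 0, q)) := Continuous.tendsto (by fun_prop) _
    filter_upwards [h2.eventually h1] with z hz hzL
    exact hz (by simpa using hzL)
  obtain ⟨ρ, hρ, hball⟩ := Metric.eventually_nhds_iff.1 key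
  obtain ⟨δ, hδ, hFδ⟩ := Metric.continuousWithinAt_iff.1 (h.continuousOn 0 h0) (ρ / 2)
    (half_pos hρ)
  have hunif := Metric.tendstoUniformlyOn_iff.1 h.lim (ρ / 2) (half_pos hρ)
  refine ⟨c, hc, min L (min (δ / 2) (ρ / 2)), by have := h.length_pos; positivity,
    min_le_left _ _, ?_⟩
  filter_upwards [hunif] with n hn x hx q hq
  have hxm := le_min_iff.1 hx.2
  have hxm' := le_min_iff.1 hxm.2
  have hxL : x ∈ Icc 0 L := ⟨hx.1, hxm.1⟩
  have hx0 : dist x 0 = x := by simp [abs_of_nonneg hx.1]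
  refine hball (y := (x, f n x)) ?_ q hq hxL
  rw [Prod.dist_eq]
  refine max_lt (by dsimp only; linarith) ?_
  have h1 := hFδ hxL (by linarith)
  have h2 := hn x hxL
  rw [dist_comm] at h2
  dsimp only
  linarith [dist_triangle (f n x) (F x) (F 0)]

theorem slope_lower_bound (h : IsViscositySeq ε L G f g F) {a s : ℝ} (has : a ≤ s)
    (hG : ∀ q ∈ Icc a s, 0 < G 0 (F 0) q) (hg : ∃ᶠ n in atTop, a ≤ g n 0) :
    ∃ η > 0, η ≤ L ∧ ∀ x ∈ Icc 0 η, F 0 + s * x ≤ F x := by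
  obtain ⟨c, hc, η, hη, hηL, hlow⟩ := h.exists_uniform_lower_bound hG
  have hsub : Icc 0 η ⊆ Icc 0 L := Icc_subset_Icc_right hηL
  have hfc : ∀ n, ContinuousOn (f n) (Icc 0 L) := fun n x hx =>
    (h.deriv_fst n x hx).continuousWithinAt
  have hgc : ∀ n, ContinuousOn (g n) (Icc 0 L) := fun n x hx =>
    (h.deriv_snd n x hx).continuousWithinAt
  have steep : ∀ τ ∈ Ioc 0 η, ∃ᶠ n in atTop, ∀ x ∈ Icc τ η, s ≤ g n x := by
    intro τ hτ
    have hlim : ∀ᶠ n in atTop, (s - a) / τ * ε n < c := by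
      have := h.eps_lim.const_mul ((s - a) / τ)
      rw [mul_zero] at this
      exact this.eventually (gt_mem_nhds hc)
    refine (hg.and_eventually (hlow.and hlim)).mono ?_
    rintro n ⟨hn0, hnc, hnε⟩
    have hε := h.eps_pos n
    have hramp : ∀ ⦃x⦄, x ∈ Icc 0 τ → a + (s - a) / τ * x ≤ g n x := by
      refine image_le_of_deriv_right_lt_deriv_boundary' (f' := fun _ => (s - a) / τ)
        (B' := fun x => G x (f n x) (g n x) / ε n) (by fun_prop) (fun x _ => ?_)
        (by simpa using hn0) ((hgc n).mono ((Icc_subset_Icc_right hτ.2).trans hsub))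
        (fun x hx => ?_) fun x hx hxe => ?_
      · simpa using ((hasDerivWithinAt_id x (Ici x)).const_mul ((s - a) / τ)).const_add a
      · have hxL : x ∈ Ico 0 L := ⟨hx.1, hx.2.trans_le (hτ.2.trans hηL)⟩
        exact hasDerivWithinAt_Ici (h.deriv_snd n x (Ico_subset_Icc_self hxL)) hxL
      · have hr0 : 0 ≤ (s - a) / τ := div_nonneg (sub_nonneg.2 has) hτ.1.le
        have hr1 : (s - a) / τ * x ≤ s - a := by
          calc (s - a) / τ * x ≤ (s - a) / τ * τ := by gcongr; exact hx.2.le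
            _ = s - a := div_mul_cancel₀ _ hτ.1.ne'
        have := hnc x ⟨hx.1, hx.2.le.trans hτ.2⟩ (g n x)
          ⟨by rw [← hxe]; nlinarith [mul_nonneg hr0 hx.1], by rw [← hxe]; linarith⟩
        rw [lt_div_iff₀ hε]
        linarith
    have hτs : s ≤ g n τ := by
      have := hramp (right_mem_Icc.2 hτ.1.le)
      rwa [div_mul_cancel₀ _ hτ.1.ne', add_sub_cancel] at this
    refine image_le_of_deriv_right_lt_deriv_boundary' (f := fun _ => s) (f' := fun _ => 0)
      (B' := fun x => G x (f n x) (g n x) / ε n) (by fun_prop)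
      (fun x _ => hasDerivWithinAt_const _ _ _) hτs
      ((hgc n).mono ((Icc_subset_Icc_left hτ.1.le).trans hsub)) (fun x hx => ?_)
      fun x hx hxe => ?_
    · have hxL : x ∈ Ico 0 L := ⟨hτ.1.le.trans hx.1, hx.2.trans_le hηL⟩
      exact hasDerivWithinAt_Ici (h.deriv_snd n x (Ico_subset_Icc_self hxL)) hxL
    · exact div_pos (hc.trans (hnc x ⟨hτ.1.le.trans hx.1, hx.2.le⟩ _
        ⟨hxe ▸ has, hxe ▸ le_rfl⟩)) hε
  have hincr : ∀ τ ∈ Ioc 0 η, ∀ x ∈ Icc τ η, F τ + s * (x - τ) ≤ F x := by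
    intro τ hτ x hx
    have hxL : x ∈ Icc 0 L := hsub ⟨hτ.1.le.trans hx.1, hx.2⟩
    have hτL : τ ∈ Icc 0 L := hsub ⟨hτ.1.le, hτ.2⟩
    have hlim : Tendsto (fun n => f n x - f n τ) atTop (𝓝 (F x - F τ)) :=
      (h.lim.tendsto_at hxL).sub (h.lim.tendsto_at hτL)
    have : s * (x - τ) ≤ F x - F τ := by
      refine ge_of_tendsto_of_frequently hlim ((steep τ hτ).mono fun n hn => ?_)
      have := image_le_of_deriv_right_le_deriv_boundary
        (f := fun x => f n τ + s * (x - τ)) (f' := fun _ => s) (a := τ) (b := η) (B := f n)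
        (B' := g n) (by fun_prop) (fun x _ => ?_) (by simp)
        ((hfc n).mono ((Icc_subset_Icc_left hτ.1.le).trans hsub)) (fun x hx => ?_)
        (fun x hx => hn x (Ico_subset_Icc_self hx)) hx
      · linarith
      · simpa using
          (((hasDerivWithinAt_id x (Ici x)).sub_const τ).const_mul s).const_add (f n τ)
      · have hxL : x ∈ Ico 0 L := ⟨hτ.1.le.trans hx.1, hx.2.trans_le hηL⟩
        exact hasDerivWithinAt_Ici (h.deriv_fst n x (Ico_subset_Icc_self hxL)) hxL
    linarith
  refine ⟨η, hη, hηL, fun x hx => ?_⟩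
  rcases hx.1.eq_or_lt with rfl | hx0
  · simp
  have : (𝓝[Ioo 0 x] (0 : ℝ)).NeBot := left_nhdsWithin_Ioo_neBot hx0
  have hFl : Tendsto F (𝓝[Ioo 0 x] 0) (𝓝 (F 0)) :=
    (h.continuousOn 0 ⟨le_rfl, h.length_pos.le⟩).mono
      fun y hy => hsub ⟨hy.1.le, hy.2.le.trans hx.2⟩
  have hl : Tendsto (fun τ => F τ + s * (x - τ)) (𝓝[Ioo 0 x] 0) (𝓝 (F 0 + s * (x - 0))) := by
    refine hFl.add (Tendsto.mono_left (Continuous.tendsto ?_ _) nhdsWithin_le_nhds)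
    fun_prop
  rw [sub_zero] at hl
  refine le_of_tendsto hl (eventually_mem_nhdsWithin.mono fun τ hτ => ?_)
  exact hincr τ ⟨hτ.1, hτ.2.le.trans hx.2⟩ x ⟨hτ.2.le, hx.2⟩

theorem le_of_isLocalMaxOn (h : IsViscositySeq ε L G f g F) {a s q : ℝ} (has : a ≤ s)
    (hG : ∀ q ∈ Icc a s, 0 < G 0 (F 0) q) (hg : ∃ᶠ n in atTop, a ≤ g n 0) {φ : ℝ → ℝ}
    (hφ : HasDerivWithinAt φ q (Icc 0 L) 0)
    (hmax : ∀ᶠ x in 𝓝[Icc 0 L] 0, F x - φ x ≤ F 0 - φ 0) : s ≤ q := by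
  obtain ⟨η, hη, hηL, hF⟩ := h.slope_lower_bound has hG hg
  have hsub : Ioo 0 η ⊆ Icc 0 L := fun x hx => ⟨hx.1.le, hx.2.le.trans hηL⟩
  have : (𝓝[Ioo 0 η] (0 : ℝ)).NeBot := left_nhdsWithin_Ioo_neBot hη
  have hsl := (hasDerivWithinAt_iff_tendsto_slope' (by simp)).1 (hφ.mono hsub)
  refine ge_of_tendsto hsl ?_
  filter_upwards [eventually_mem_nhdsWithin, hmax.filter_mono (nhdsWithin_mono _ hsub)]
    with x hx hxm
  rw [slope_def_field, sub_zero, le_div_iff₀ hx.1]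
  linarith [hF x (Ioo_subset_Icc_self hx)]

theorem continuous_slice (h : IsViscositySeq ε L G f g F) {y : ℝ} (hy : y ∈ Icc 0 L) (r : ℝ) :
    Continuous fun q => G y r q := by
  rw [← continuousOn_univ]
  refine h.cont.comp (f := fun q : ℝ => (y, r, q)) (by fun_prop) ?_
  intro q _
  simpa using hy

/-- Subsolution property of the limit at interior points. -/
theorem nonpos_of_isLocalMaxOn (h : IsViscositySeq ε L G f g F) {y p : ℝ} (hy : y ∈ Ioo 0 L)
    {φ : ℝ → ℝ} (hφ : HasDerivWithinAt φ p (Icc 0 L) y)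
    (hmax : ∀ᶠ x in 𝓝[Icc 0 L] y, F x - φ x ≤ F y - φ y) : G y (F y) p ≤ 0 := by
  by_contra! hpos
  obtain ⟨δ, hδ, hball⟩ := Metric.eventually_nhds_iff.1 <|
    (h.continuous_slice (Ioo_subset_Icc_self hy) (F y)).continuousAt.eventually
      (lt_mem_nhds hpos)
  have key : ∀ σ L' : ℝ, 0 < L' → σ * σ = 1 →
      MapsTo (fun x => y + σ * x) (Icc 0 L') (Icc 0 L) →
      ¬ ∃ᶠ n in atTop, σ * p ≤ σ * g n y := by
    intro σ L' hL' hσ hm hfreq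
    have hpb := h.pullback hL' hσ hm
    have hσa : |σ| = 1 := by
      rcases mul_self_eq_one_iff.1 hσ with rfl | rfl <;> simp
    have hc : HasDerivWithinAt (fun x => y + σ * x) σ (Icc 0 L') 0 := by
      simpa using ((hasDerivWithinAt_id (0 : ℝ) (Icc 0 L')).const_mul σ).const_add y
    have hφ' : HasDerivWithinAt φ p (Icc 0 L) (y + σ * 0) := by simpa using hφ
    have hd : HasDerivWithinAt (fun x => φ (y + σ * x)) (σ * p) (Icc 0 L') 0 := by
      simpa [mul_comm, Function.comp_def] using hφ'.comp 0 hc hm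
    have ht : Tendsto (fun x => y + σ * x) (𝓝[Icc 0 L'] 0) (𝓝[Icc 0 L] y) := by
      simpa using hc.continuousWithinAt.tendsto_nhdsWithin hm
    have := hpb.le_of_isLocalMaxOn (a := σ * p) (s := σ * p + δ / 2) (by linarith)
      (fun q hq => ?_) (by simpa using hfreq) hd (by simpa using ht.eventually hmax)
    · linarith
    · simp only [mul_zero, add_zero]
      refine hball ?_
      have e : σ * q - p = σ * (q - σ * p) := by linear_combination p * hσ
      rw [Real.dist_eq, e, abs_mul, hσa, one_mul, abs_lt]
      constructor <;> linarith [hq.1, hq.2]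
  have h1 := key 1 (L - y) (by linarith [hy.2]) (by norm_num)
    fun x hx => ⟨by linarith [hx.1, hy.1], by linarith [hx.2]⟩
  have h2 := key (-1) y hy.1 (by norm_num)
    fun x hx => ⟨by linarith [hx.2], by linarith [hx.1, hy.2]⟩
  rw [not_frequently] at h1 h2
  obtain ⟨n, hn1, hn2⟩ := (h1.and h2).exists
  linarith

/-- Supersolution property of the limit at interior points. -/
theorem nonneg_of_isLocalMinOn (h : IsViscositySeq ε L G f g F) {y p : ℝ} (hy : y ∈ Ioo 0 L)
    {φ : ℝ → ℝ} (hφ : HasDerivWithinAt φ p (Icc 0 L) y)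
    (hmin : ∀ᶠ x in 𝓝[Icc 0 L] y, F y - φ y ≤ F x - φ x) : 0 ≤ G y (F y) p := by
  have := h.neg.nonpos_of_isLocalMaxOn hy hφ.neg
    (hmin.mono fun x hx => by simp only [Pi.neg_apply]; linarith)
  simpa using this

/-- Endpoint bound when the Hamiltonian is nondecreasing in `|q|` there: a function touching
the limit from above has nonpositive Hamiltonian if its slope is nonpositive. -/
theorem nonpos_of_isLocalMaxOn_left (h : IsViscositySeq ε L G f g F)
    (hmono : ∀ q q', |q| ≤ |q'| → G 0 (F 0) q ≤ G 0 (F 0) q') {C : ℝ} (hC : ∀ n, |g n 0| ≤ C)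
    {q : ℝ} (hq : q ≤ 0) {φ : ℝ → ℝ} (hφ : HasDerivWithinAt φ q (Icc 0 L) 0)
    (hmax : ∀ᶠ x in 𝓝[Icc 0 L] 0, F x - φ x ≤ F 0 - φ 0) : G 0 (F 0) q ≤ 0 := by
  by_contra! hpos
  obtain ⟨δ, hδ, hball⟩ := Metric.eventually_nhds_iff.1 <|
    (h.continuous_slice ⟨le_rfl, h.length_pos.le⟩ (F 0)).continuousAt.eventually
      (lt_mem_nhds hpos)
  have := h.le_of_isLocalMaxOn (a := min (-C) q) (s := q + δ / 2)
    (by linarith [min_le_right (-C) q]) (fun q' hq' => ?_)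
    (.of_forall fun n => (min_le_left _ _).trans (abs_le.1 (hC n)).1) hφ hmax
  · linarith
  · rcases le_total q q' with hqq | hqq
    · refine hball ?_
      rw [Real.dist_eq, abs_lt]
      constructor <;> linarith [hq'.2]
    · refine hpos.trans_le (hmono _ _ ?_)
      rw [abs_of_nonpos hq, abs_of_nonpos (hqq.trans hq)]
      linarith

/-- Endpoint bound when the Hamiltonian is nondecreasing in `|q|` there and the outgoing slopes
of the solutions are frequently nonpositive. -/
theorem nonneg_of_isLocalMinOn_left (h : IsViscositySeq ε L G f g F)
    (hmono : ∀ q q', |q| ≤ |q'| → G 0 (F 0) q ≤ G 0 (F 0) q')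
    (hg : ∃ᶠ n in atTop, g n 0 ≤ 0) {q : ℝ} {φ : ℝ → ℝ}
    (hφ : HasDerivWithinAt φ q (Icc 0 L) 0)
    (hmin : ∀ᶠ x in 𝓝[Icc 0 L] 0, F 0 - φ 0 ≤ F x - φ x) : 0 ≤ G 0 (F 0) q := by
  by_contra! hneg
  have habs : G 0 (F 0) |q| < 0 := (hmono _ _ (abs_abs q).le).trans_lt hneg
  obtain ⟨δ, hδ, hball⟩ := Metric.eventually_nhds_iff.1 <|
    (h.continuous_slice ⟨le_rfl, h.length_pos.le⟩ (F 0)).continuousAt.eventually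
      (gt_mem_nhds habs)
  have hs : 0 ≤ |q| + δ / 2 := by positivity
  have := h.neg.le_of_isLocalMaxOn (a := 0) (s := |q| + δ / 2) hs (fun q' hq' => ?_)
    (hg.mono fun n hn => by linarith) hφ.neg
    (hmin.mono fun x hx => by simp only [Pi.neg_apply]; linarith)
  · linarith [neg_le_abs q]
  · rw [neg_neg, neg_pos]
    have hb : G 0 (F 0) (|q| + δ / 2) < 0 := by
      refine hball ?_
      rw [Real.dist_eq, add_sub_cancel_left, abs_of_pos (half_pos hδ)]
      linarith
    refine (hmono _ _ ?_).trans_lt hb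
    rw [abs_neg, abs_of_nonneg hq'.1, abs_of_nonneg hs]
    exact hq'.2

end IsViscositySeq

end VanishingViscosity

namespace Network

open Filter Topology

variable {N : Network}

theorem sgn_mul_self (i : N.I) (j : N.J) : N.sgn i j * N.sgn i j = 1 := by
  unfold sgn
  split_ifs <;> norm_num

theorem param_mem_edge (i : N.I) (j : N.J) : N.param i j ∈ N.edge j := by
  have := (N.l_pos j).le
  unfold param edge
  split_ifs <;> simpa using this

theorem mapsTo_outgoing (i : N.I) (j : N.J) :
    MapsTo (fun x => N.param i j + N.sgn i j * x) (Icc 0 (N.l j)) (Icc 0 (N.l j)) := by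
  intro x hx
  unfold param sgn
  split_ifs
  · simpa using hx
  · constructor <;> linarith [hx.1, hx.2]

theorem exists_ne_mem_Inc {i : N.I} (hi : i ∈ N.IT) {j : N.J} (hj : j ∈ N.Inc i) :
    ∃ k ∈ N.Inc i, k ≠ j := by
  by_contra! hk
  refine hi (N.deg_one_bd i (Set.ncard_eq_one.2 ⟨j, ?_⟩))
  exact Set.eq_singleton_iff_unique_mem.2 ⟨hj, hk⟩

theorem exists_outgoing_slope_nonpos {i : N.I} {β : N.I → N.J → ℝ}
    (hβ : ∀ j ∈ N.Inc i, 0 < β i j) {w : N.J → ℝ → ℝ} (hw : N.kir β w i = 0) {j : N.J}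
    (hj : j ∈ N.Inc i) : ∃ k ∈ N.Inc i, N.sgn i k * N.pd w k (N.param i k) ≤ 0 := by
  by_contra! hpos
  refine hw.not_gt (Finset.sum_pos' (fun k _ => ?_) ⟨j, Finset.mem_univ j, ?_⟩)
  · split_ifs with hk
    · beta_reduce
      rw [mul_assoc]
      exact (mul_pos (hβ k hk) (hpos k hk)).le
    · exact le_rfl
  · rw [if_pos hj]
    beta_reduce
    rw [mul_assoc]
    exact mul_pos (hβ j hj) (hpos j hj)

theorem hamiltonian_mono_abs {H : N.J → ℝ → ℝ → ℝ → ℝ} (h0 : N.H0 H) (h3 : N.H3 H)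
    (h6 : N.H6 H) {i : N.I} (hi : i ∈ N.IT) {j : N.J} (hj : j ∈ N.Inc i) (r : ℝ) {q q' : ℝ}
    (hq : |q| ≤ |q'|) : H j (N.param i j) r q ≤ H j (N.param i j) r q' := by
  have habs : ∀ p, H j (N.param i j) r |p| = H j (N.param i j) r p := by
    intro p
    rcases abs_choice p with hp | hp <;> rw [hp]
    exact (h6 i hi j hj r p).symm
  have hc : Continuous fun p => H j (N.param i j) r p := by
    rw [← continuousOn_univ]
    refine (h0 j).comp (f := fun p : ℝ => (N.param i j, r, p)) (by fun_prop) ?_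
    intro p _
    simpa using N.param_mem_edge i j
  rw [← habs q, ← habs q']
  rcases hq.eq_or_lt with he | hlt
  · rw [he]
  have hpos : 0 < |q'| := (abs_nonneg q).trans_lt hlt
  have hl : Tendsto (fun p => H j (N.param i j) r p) (𝓝[>] |q|) (𝓝 (H j (N.param i j) r |q|)) :=
    hc.continuousAt.mono_left nhdsWithin_le_nhds
  refine le_of_tendsto hl ?_
  filter_upwards [Ioo_mem_nhdsGT hlt] with p hp
  exact h3 i hi j hj r ((abs_nonneg q).trans_lt hp.1) hpos hp.2.le

theorem eventually_nhdsWithin_of_dist {s : Set ℝ} {y : ℝ} {P : ℝ → Prop}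
    (h : ∃ δ > 0, ∀ x ∈ s, |x - y| < δ → P x) : ∀ᶠ x in 𝓝[s] y, P x := by
  obtain ⟨δ, hδ, hP⟩ := h
  rw [eventually_nhdsWithin_iff, Metric.eventually_nhds_iff]
  exact ⟨δ, hδ, fun x hx hxs => hP x hxs hx⟩

theorem isViscositySeq_edge {H : N.J → ℝ → ℝ → ℝ → ℝ} (h0 : N.H0 H) {ε : ℕ → ℝ}
    (hεpos : ∀ n, 0 < ε n) (hεlim : Tendsto ε atTop (𝓝 0)) {u : ℕ → N.J → ℝ → ℝ}
    (hC2 : ∀ n, N.IsC2 (u n)) {j : N.J}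
    (hsol : ∀ n, ∀ x ∈ Ioo (0 : ℝ) (N.l j),
      -(ε n) * N.pd2 (u n) j x + H j x (u n j x) (N.pd (u n) j x) = 0)
    {v : N.J → ℝ → ℝ}
    (hconv : TendstoUniformlyOn (fun n => u n j) (v j) atTop (N.edge j)) :
    IsViscositySeq ε (N.l j) (H j) (fun n => u n j) (fun n => N.pd (u n) j) (v j) := by
  have hl := N.l_pos j
  have hU : UniqueDiffOn ℝ (N.edge j) := uniqueDiffOn_Icc hl
  have hone : ∀ n, ContDiffOn ℝ 1 (N.pd (u n) j) (N.edge j) := fun n =>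
    ((hC2 n).2 j).derivWithin hU (by norm_num)
  have heq : ∀ n, EqOn (fun x => H j x (u n j x) (N.pd (u n) j x) / ε n) (N.pd2 (u n) j)
      (Icc 0 (N.l j)) := by
    intro n
    refine EqOn.of_subset_closure (s := Ioo 0 (N.l j)) (fun x hx => ?_) ?_ ?_ Ioo_subset_Icc_self
      (closure_Ioo hl.ne).ge
    · rw [div_eq_iff (hεpos n).ne']
      linarith [hsol n x hx]
    · refine ContinuousOn.div_const ((h0 j).comp
        (f := fun x => (x, u n j x, N.pd (u n) j x)) ?_ fun x hx => ?_) _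
      · exact continuousOn_id.prodMk (((hC2 n).2 j).continuousOn.prodMk (hone n).continuousOn)
      · exact ⟨hx, mem_univ _, mem_univ _⟩
    · exact (hone n).continuousOn_derivWithin hU le_rfl
  refine ⟨hl, hεpos, hεlim, h0 j, fun n x hx => ?_, fun n x hx => ?_, hconv⟩
  · exact (((hC2 n).2 j).differentiableOn (by norm_num) x hx).hasDerivWithinAt
  · have := heq n hx
    simp only at this
    rw [this]
    exact ((hone n).differentiableOn (by norm_num) x hx).hasDerivWithinAt

theorem hasDerivWithinAt_outgoing {φ : N.J → ℝ → ℝ} {i : N.I} {j : N.J}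
    (hφ : DifferentiableWithinAt ℝ (φ j) (N.edge j) (N.param i j)) :
    HasDerivWithinAt (fun x => φ j (N.param i j + N.sgn i j * x))
      (N.sgn i j * N.pd φ j (N.param i j)) (Icc 0 (N.l j)) 0 := by
  have hc : HasDerivWithinAt (fun x => N.param i j + N.sgn i j * x) (N.sgn i j)
      (Icc 0 (N.l j)) 0 := by
    simpa using ((hasDerivWithinAt_id (0 : ℝ) (Icc 0 (N.l j))).const_mul (N.sgn i j)).const_add
      (N.param i j)
  have hφ' : HasDerivWithinAt (φ j) (N.pd φ j (N.param i j)) (Icc 0 (N.l j))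
      (N.param i j + N.sgn i j * 0) := by
    rw [mul_zero, add_zero]
    exact hφ.hasDerivWithinAt
  simpa [mul_comm, Function.comp_def] using hφ'.comp 0 hc (mapsTo_outgoing i j)

theorem tendsto_outgoing (i : N.I) (j : N.J) :
    Tendsto (fun x => N.param i j + N.sgn i j * x) (𝓝[Icc 0 (N.l j)] 0)
      (𝓝[N.edge j] (N.param i j)) := by
  have hc : ContinuousWithinAt (fun x => N.param i j + N.sgn i j * x) (Icc 0 (N.l j)) 0 := by
    fun_prop
  simpa [edge] using hc.tendsto_nhdsWithin (mapsTo_outgoing i j)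

section Vertex

variable {H : N.J → ℝ → ℝ → ℝ → ℝ} {ε : ℕ → ℝ} {u : ℕ → N.J → ℝ → ℝ} {v φ : N.J → ℝ → ℝ}
  {i : N.I} {j : N.J}

theorem hamiltonian_nonpos_at_vertex
    (hs : IsViscositySeq ε (N.l j) (H j) (fun n => u n j) (fun n => N.pd (u n) j) (v j))
    (hmono : ∀ q q', |q| ≤ |q'| → H j (N.param i j) (v j (N.param i j)) q ≤
      H j (N.param i j) (v j (N.param i j)) q') {C : ℝ}
    (hC : ∀ n, |N.pd (u n) j (N.param i j)| ≤ C)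
    (hφ : DifferentiableWithinAt ℝ (φ j) (N.edge j) (N.param i j))
    (hslope : N.sgn i j * N.pd φ j (N.param i j) ≤ 0)
    (hmax : ∀ᶠ x in 𝓝[N.edge j] (N.param i j),
      v j x - φ j x ≤ v j (N.param i j) - φ j (N.param i j)) :
    H j (N.param i j) (v j (N.param i j)) (N.pd φ j (N.param i j)) ≤ 0 := by
  have hσ := sgn_mul_self i j
  have hσa : |N.sgn i j| = 1 := by
    rcases mul_self_eq_one_iff.1 hσ with h | h <;> simp [h]
  have := (hs.pullback (N.l_pos j) hσ (mapsTo_outgoing i j)).nonpos_of_isLocalMaxOn_left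
    (fun q q' hq => by simpa using hmono _ _ (by simpa [abs_mul, hσa] using hq))
    (fun n => by simpa [abs_mul, hσa] using hC n) hslope (hasDerivWithinAt_outgoing hφ)
    (by simpa using (tendsto_outgoing i j).eventually hmax)
  simpa [← mul_assoc, hσ] using this

theorem hamiltonian_nonneg_at_vertex
    (hs : IsViscositySeq ε (N.l j) (H j) (fun n => u n j) (fun n => N.pd (u n) j) (v j))
    (hmono : ∀ q q', |q| ≤ |q'| → H j (N.param i j) (v j (N.param i j)) q ≤
      H j (N.param i j) (v j (N.param i j)) q')
    (hg : ∃ᶠ n in atTop, N.sgn i j * N.pd (u n) j (N.param i j) ≤ 0)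
    (hφ : DifferentiableWithinAt ℝ (φ j) (N.edge j) (N.param i j))
    (hmin : ∀ᶠ x in 𝓝[N.edge j] (N.param i j),
      v j (N.param i j) - φ j (N.param i j) ≤ v j x - φ j x) :
    0 ≤ H j (N.param i j) (v j (N.param i j)) (N.pd φ j (N.param i j)) := by
  have hσ := sgn_mul_self i j
  have hσa : |N.sgn i j| = 1 := by
    rcases mul_self_eq_one_iff.1 hσ with h | h <;> simp [h]
  have := (hs.pullback (N.l_pos j) hσ (mapsTo_outgoing i j)).nonneg_of_isLocalMinOn_left
    (fun q q' hq => by simpa using hmono _ _ (by simpa [abs_mul, hσa] using hq))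
    (by simpa using hg) (hasDerivWithinAt_outgoing hφ)
    (by simpa using (tendsto_outgoing i j).eventually hmin)
  simpa [← mul_assoc, hσ] using this

end Vertex

theorem IsTestJK.abs_pd_eq {φ : N.J → ℝ → ℝ} {i : N.I} {j k : N.J} (h : N.IsTestJK φ i j k) :
    |N.pd φ j (N.param i j)| = |N.pd φ k (N.param i k)| := by
  have hσ : ∀ m, |N.sgn i m| = 1 := fun m => by
    rcases mul_self_eq_one_iff.1 (sgn_mul_self i m) with h | h <;> simp [h]
  have := congrArg abs (eq_neg_of_add_eq_zero_left h.2.2.2)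
  simpa [abs_mul, hσ] using this

/-- At a transition vertex, the Hamiltonians of two incident edges agree on the derivatives of a
test function. -/
theorem hamiltonian_eq_of_isTestJK {H : N.J → ℝ → ℝ → ℝ → ℝ} (h5 : N.H5 H) (h6 : N.H6 H)
    {v φ : N.J → ℝ → ℝ} (hv : N.Compat v) {i : N.I} (hi : i ∈ N.IT) {j k : N.J}
    (hj : j ∈ N.Inc i) (hk : k ∈ N.Inc i) (hφ : N.IsTestJK φ i j k) :
    H j (N.param i j) (v j (N.param i j)) (N.pd φ j (N.param i j)) =
      H k (N.param i k) (v k (N.param i k)) (N.pd φ k (N.param i k)) := by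
  rw [h5 i hi j hj k hk, hv i j hj k hk]
  rcases abs_eq_abs.1 hφ.abs_pd_eq with h | h <;> rw [h]
  exact (h6 i hi k hk _ _).symm

end Network

open Network in
/-- **Theorem 5.1** (convergence of the vanishing viscosity method). -/
theorem vanishing_viscosity_convergence
    (N : Network) (H : N.J → ℝ → ℝ → ℝ → ℝ)
    (hH0 : N.H0 H) (hH1 : N.H1 H) (hH3 : N.H3 H) (hH4 : N.H4 H)
    (hH5 : N.H5 H) (hH6 : N.H6 H)
    (β : N.I → N.J → ℝ)
    (hβ : ∀ i ∈ N.IT, ∀ j ∈ N.Inc i, 0 < β i j)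
    (ε : ℕ → ℝ) (hεpos : ∀ n, 0 < ε n)
    (hεlim : Filter.Tendsto ε Filter.atTop (nhds 0))
    (u : ℕ → N.J → ℝ → ℝ)
    (hsol : ∀ n, N.IsC2Star β (u n) ∧
      ∀ j, ∀ x ∈ Set.Ioo (0 : ℝ) (N.l j),
        -(ε n) * N.pd2 (u n) j x + H j x (u n j x) (N.pd (u n) j x) = 0)
    (hbd : ∃ C : ℝ, ∀ n, ∀ j, ∀ x ∈ N.edge j,
      |u n j x| ≤ C ∧ |N.pd (u n) j x| ≤ C)
    (v : N.J → ℝ → ℝ) (hv : N.IsCont v)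
    (hconv : ∀ j, TendstoUniformlyOn (fun n => u n j) (v j) Filter.atTop (N.edge j)) :
    N.IsViscSol H v := by
  obtain ⟨C, hC⟩ := hbd
  have hs := fun j => isViscositySeq_edge hH0 hεpos hεlim (fun n => (hsol n).1.1)
    (fun n => (hsol n).2 j) (hconv j)
  have hmono : ∀ i ∈ N.IT, ∀ j ∈ N.Inc i, ∀ q q', |q| ≤ |q'| →
      H j (N.param i j) (v j (N.param i j)) q ≤ H j (N.param i j) (v j (N.param i j)) q' :=
    fun i hi j hj q q' hq => hamiltonian_mono_abs hH0 hH3 hH6 hi hj _ hq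
  refine ⟨hv, ⟨⟨hv.1, fun j => (hv.2 j).upperSemicontinuousOn⟩, ?_, ?_⟩,
    ⟨⟨hv.1, fun j => (hv.2 j).lowerSemicontinuousOn⟩, ?_, ?_⟩⟩
  · intro j y hy φ _ hφ hmax
    exact (hs j).nonpos_of_isLocalMaxOn hy hφ.hasDerivWithinAt
      (eventually_nhdsWithin_of_dist hmax)
  · rintro i hi j hj k hk - φ hφ ⟨δ, hδ, hmj, hmk⟩
    have hsub : ∀ m ∈ N.Inc i, DifferentiableWithinAt ℝ (φ m) (N.edge m) (N.param i m) →
        (∀ x ∈ N.edge m, |x - N.param i m| < δ →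
          v m x - φ m x ≤ v m (N.param i m) - φ m (N.param i m)) →
        N.sgn i m * N.pd φ m (N.param i m) ≤ 0 →
        H m (N.param i m) (v m (N.param i m)) (N.pd φ m (N.param i m)) ≤ 0 :=
      fun m hm hd hmax hslope => hamiltonian_nonpos_at_vertex (hs m) (hmono i hi m hm)
        (fun n => (hC n m _ (param_mem_edge i m)).2) hd hslope
        (eventually_nhdsWithin_of_dist ⟨δ, hδ, hmax⟩)
    rcases le_total (N.sgn i j * N.pd φ j (N.param i j)) 0 with hp | hp
    · exact hsub j hj hφ.2.1 hmj hp
    · rw [hamiltonian_eq_of_isTestJK hH5 hH6 hv.1 hi hj hk hφ]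
      exact hsub k hk hφ.2.2.1 hmk (by linarith [hφ.2.2.2])
  · intro j y hy φ _ hφ hmin
    exact (hs j).nonneg_of_isLocalMinOn hy hφ.hasDerivWithinAt
      (eventually_nhdsWithin_of_dist hmin)
  · intro i hi j hj
    obtain ⟨m, hm, hfreq⟩ : ∃ m ∈ N.Inc i, ∃ᶠ n in Filter.atTop,
        N.sgn i m * N.pd (u n) m (N.param i m) ≤ 0 := by
      by_contra! hno
      have hall : ∀ᶠ n in Filter.atTop, ∀ m, m ∈ N.Inc i →
          ¬ N.sgn i m * N.pd (u n) m (N.param i m) ≤ 0 := by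
        refine Filter.eventually_all.2 fun m => ?_
        by_cases hm : m ∈ N.Inc i
        · exact (hno m hm).mono fun n hn _ => hn.not_ge
        · exact .of_forall fun n hm' => absurd hm' hm
      obtain ⟨n, hn⟩ := hall.exists
      obtain ⟨m, hm, hle⟩ := exists_outgoing_slope_nonpos (hβ i hi) ((hsol n).1.2 i hi) hj
      exact hn m hm hle
    by_cases hmj : m = j
    · subst hmj
      obtain ⟨k, hk, hkm⟩ := exists_ne_mem_Inc hi hm
      refine ⟨k, hk, hkm, fun φ hφ ⟨δ, hδ, hmin, _⟩ => ?_⟩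
      exact hamiltonian_nonneg_at_vertex (hs m) (hmono i hi m hm) hfreq hφ.2.1
        (eventually_nhdsWithin_of_dist ⟨δ, hδ, hmin⟩)
    · refine ⟨m, hm, hmj, fun φ hφ ⟨δ, hδ, _, hmin⟩ => ?_⟩
      rw [hamiltonian_eq_of_isTestJK hH5 hH6 hv.1 hi hj hm hφ]
      exact hamiltonian_nonneg_at_vertex (hs m) (hmono i hi m hm) hfreq hφ.2.2.1
        (eventually_nhdsWithin_of_dist ⟨δ, hδ, hmin⟩)
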